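/- Let (Ω, F, P) be a probability space, A a nonempty index set, δ > 0 and C > 0. For each k ∈ ℕ and a ∈ A let η_k^a and η^a be real random variables such that: (i) sup_{a∈A} E[|η_k^a − η^a|] → 0 as k → ∞; (ii) sup_{k∈ℕ} sup_{a∈A} E[exp{(1+δ) η_k^a}] ≤ C; and (iii) sup_{a∈A} E[exp{(1+δ) η^a}] ≤ C. Then sup_{a∈A} |E[exp{η_k^a}] − E[exp{η^a}]| → 0 as k → ∞. -/

import Mathlib

open MeasureTheory Filter
open scoped ENNReal

theorem abs_exp_sub_exp_le_of_exp_moment {δ : ℝ} (hδ : 0 < δ) (M x y : ℝ) :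
    |Real.exp x - Real.exp y| ≤ Real.exp M * |x - y| +
      Real.exp (-(δ * M)) * (Real.exp ((1 + δ) * x) + Real.exp ((1 + δ) * y)) := by
  wlog h : y ≤ x generalizing x y
  · have := this y x (not_le.mp h).le
    rwa [abs_sub_comm, abs_sub_comm y x, add_comm (Real.exp ((1 + δ) * y))] at this
  rw [abs_of_nonneg (sub_nonneg.mpr (Real.exp_le_exp.mpr h)), abs_of_nonneg (sub_nonneg.mpr h)]
  rcases le_total x M with hx | hx
  · have h1 : Real.exp x - Real.exp y ≤ Real.exp x * (x - y) := by
      have h2 : Real.exp y = Real.exp x * Real.exp (y - x) := by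
        rw [← Real.exp_add]; congr 1; ring
      have h3 := mul_le_mul_of_nonneg_left (Real.add_one_le_exp (y - x)) (Real.exp_pos x).le
      rw [h2]
      linarith
    have h4 := mul_le_mul_of_nonneg_right (Real.exp_le_exp.mpr hx) (sub_nonneg.mpr h)
    have h5 : 0 ≤ Real.exp (-(δ * M)) * (Real.exp ((1 + δ) * x) + Real.exp ((1 + δ) * y)) := by
      positivity
    linarith
  · have h1 : Real.exp x ≤ Real.exp (-(δ * M)) * Real.exp ((1 + δ) * x) := by
      rw [← Real.exp_add, Real.exp_le_exp]
      nlinarith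
    have h2 : 0 ≤ Real.exp M * (x - y) := mul_nonneg (Real.exp_pos M).le (sub_nonneg.mpr h)
    have h3 : 0 ≤ Real.exp (-(δ * M)) * Real.exp ((1 + δ) * y) := by positivity
    have h4 := Real.exp_pos y
    linarith

theorem integrable_and_integral_le_of_lintegral_ofReal_le {Ω : Type*} [MeasurableSpace Ω]
    {P : Measure Ω} {f : Ω → ℝ} (hf : Measurable f) (hf0 : ∀ ω, 0 ≤ f ω) {c : ℝ} (hc : 0 ≤ c)
    (h : ∫⁻ ω, ENNReal.ofReal (f ω) ∂P ≤ ENNReal.ofReal c) :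
    Integrable f P ∧ ∫ ω, f ω ∂P ≤ c := by
  have hi : Integrable f P :=
    (lintegral_ofReal_ne_top_iff_integrable hf.aestronglyMeasurable
      (Eventually.of_forall hf0)).mp (ne_top_of_le_ne_top ENNReal.ofReal_ne_top h)
  refine ⟨hi, (ENNReal.ofReal_le_ofReal_iff hc).mp ?_⟩
  rwa [ofReal_integral_eq_lintegral_ofReal hi (Eventually.of_forall hf0)]

theorem integrable_exp_of_integrable_exp_mul {Ω : Type*} [MeasurableSpace Ω]
    {P : Measure Ω} [IsFiniteMeasure P] {δ : ℝ} (hδ : 0 < δ) {X : Ω → ℝ} (hX : Measurable X)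
    (h : Integrable (fun ω => Real.exp ((1 + δ) * X ω)) P) :
    Integrable (fun ω => Real.exp (X ω)) P := by
  refine ((integrable_const (1 : ℝ)).add h).mono' hX.exp.aestronglyMeasurable
    (Eventually.of_forall fun ω => ?_)
  rw [Real.norm_eq_abs, Real.abs_exp, Pi.add_apply]
  rcases le_total (X ω) 0 with hx | hx
  · have := Real.exp_le_one_iff.mpr hx
    have := Real.exp_pos ((1 + δ) * X ω)
    linarith
  · have : Real.exp (X ω) ≤ Real.exp ((1 + δ) * X ω) := Real.exp_le_exp.mpr (by nlinarith)
    linarith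

theorem abs_integral_exp_sub_integral_exp_le {Ω : Type*} [MeasurableSpace Ω]
    {P : Measure Ω} [IsFiniteMeasure P] {δ C d : ℝ} (hδ : 0 < δ) (hC : 0 ≤ C) (hd : 0 ≤ d)
    {X Y : Ω → ℝ} (hX : Measurable X) (hY : Measurable Y)
    (hXY : ∫⁻ ω, ENNReal.ofReal |X ω - Y ω| ∂P ≤ ENNReal.ofReal d)
    (hXC : ∫⁻ ω, ENNReal.ofReal (Real.exp ((1 + δ) * X ω)) ∂P ≤ ENNReal.ofReal C)
    (hYC : ∫⁻ ω, ENNReal.ofReal (Real.exp ((1 + δ) * Y ω)) ∂P ≤ ENNReal.ofReal C) (M : ℝ) :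
    |(∫ ω, Real.exp (X ω) ∂P) - ∫ ω, Real.exp (Y ω) ∂P| ≤
      Real.exp M * d + Real.exp (-(δ * M)) * (C + C) := by
  obtain ⟨iXY, bXY⟩ := integrable_and_integral_le_of_lintegral_ofReal_le
    (f := fun ω => |X ω - Y ω|) (by fun_prop) (fun _ => abs_nonneg _) hd hXY
  obtain ⟨iX, bX⟩ := integrable_and_integral_le_of_lintegral_ofReal_le
    (hX.const_mul (1 + δ)).exp (fun _ => (Real.exp_pos _).le) hC hXC
  obtain ⟨iY, bY⟩ := integrable_and_integral_le_of_lintegral_ofReal_le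
    (hY.const_mul (1 + δ)).exp (fun _ => (Real.exp_pos _).le) hC hYC
  have jX := integrable_exp_of_integrable_exp_mul hδ hX iX
  have jY := integrable_exp_of_integrable_exp_mul hδ hY iY
  have iS : Integrable (fun ω => Real.exp ((1 + δ) * X ω) + Real.exp ((1 + δ) * Y ω)) P :=
    iX.add iY
  calc |(∫ ω, Real.exp (X ω) ∂P) - ∫ ω, Real.exp (Y ω) ∂P|
      = |∫ ω, (Real.exp (X ω) - Real.exp (Y ω)) ∂P| := by rw [integral_sub jX jY]
    _ ≤ ∫ ω, |Real.exp (X ω) - Real.exp (Y ω)| ∂P := abs_integral_le_integral_abs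
    _ ≤ ∫ ω, (Real.exp M * |X ω - Y ω| + Real.exp (-(δ * M)) *
          (Real.exp ((1 + δ) * X ω) + Real.exp ((1 + δ) * Y ω))) ∂P :=
        integral_mono (jX.sub jY).abs ((iXY.const_mul _).add (iS.const_mul _))
          fun ω => abs_exp_sub_exp_le_of_exp_moment hδ M (X ω) (Y ω)
    _ = Real.exp M * (∫ ω, |X ω - Y ω| ∂P) + Real.exp (-(δ * M)) *
          ((∫ ω, Real.exp ((1 + δ) * X ω) ∂P) + ∫ ω, Real.exp ((1 + δ) * Y ω) ∂P) := by
        rw [integral_add (iXY.const_mul _) (iS.const_mul _), integral_const_mul,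
          integral_const_mul, integral_add iX iY]
    _ ≤ Real.exp M * d + Real.exp (-(δ * M)) * (C + C) := by gcongr

/-- Uniform convergence of exponential moments: if `sup_a E[|η_k^a - η^a|] → 0` and the
exponential moments `E[exp((1+δ)η_k^a)]`, `E[exp((1+δ)η^a)]` are bounded by `C` uniformly
in `k` and `a`, then `sup_a |E[exp(η_k^a)] - E[exp(η^a)]| → 0` as `k → ∞`. -/
theorem uniform_convergence_exp_moments {Ω : Type*} [MeasurableSpace Ω]
    (P : Measure Ω) [IsProbabilityMeasure P] {A : Type*} [Nonempty A]
    (δ C : ℝ) (hδ : 0 < δ) (hC : 0 < C)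
    (η : ℕ → A → Ω → ℝ) (η' : A → Ω → ℝ)
    (hmeas : ∀ k a, Measurable (η k a)) (hmeas' : ∀ a, Measurable (η' a))
    (hL1 : Tendsto (fun k => ⨆ a, ∫⁻ ω, ENNReal.ofReal |η k a ω - η' a ω| ∂P)
      atTop (nhds 0))
    (hexp : ∀ k a, ∫⁻ ω, ENNReal.ofReal (Real.exp ((1 + δ) * η k a ω)) ∂P
      ≤ ENNReal.ofReal C)
    (hexp' : ∀ a, ∫⁻ ω, ENNReal.ofReal (Real.exp ((1 + δ) * η' a ω)) ∂P
      ≤ ENNReal.ofReal C) :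
    Tendsto (fun k => ⨆ a, |(∫ ω, Real.exp (η k a ω) ∂P) - ∫ ω, Real.exp (η' a ω) ∂P|)
      atTop (nhds 0) := by
  rw [Metric.tendsto_nhds]
  intro ε hε
  have hlim : Tendsto (fun M : ℝ => Real.exp (-(δ * M)) * (C + C)) atTop (nhds 0) := by
    simpa using (Real.tendsto_exp_neg_atTop_nhds_zero.comp
      (tendsto_id.const_mul_atTop hδ)).mul_const (C + C)
  obtain ⟨M, hM⟩ := (hlim.eventually_lt_const (show (0 : ℝ) < ε / 3 by positivity)).exists
  have hd : 0 < Real.exp (-M) * (ε / 3) := by positivity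
  filter_upwards [hL1.eventually_lt_const (ENNReal.ofReal_pos.mpr hd)] with k hk
  have hb : ⨆ a, |(∫ ω, Real.exp (η k a ω) ∂P) - ∫ ω, Real.exp (η' a ω) ∂P|
      ≤ ε / 3 + ε / 3 := by
    refine ciSup_le fun a => ?_
    have h := abs_integral_exp_sub_integral_exp_le hδ hC.le hd.le (hmeas k a) (hmeas' a)
      ((le_iSup (fun a => ∫⁻ ω, ENNReal.ofReal |η k a ω - η' a ω| ∂P) a).trans hk.le)
      (hexp k a) (hexp' a) M
    rw [← mul_assoc, ← Real.exp_add, add_neg_cancel, Real.exp_zero, one_mul] at h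
    linarith
  rw [Real.dist_eq, sub_zero, abs_of_nonneg (Real.iSup_nonneg fun a => abs_nonneg _)]
  linarith
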